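/- Let A be a commutative ring that is an algebra over ℚ, let S be a ℚ-submodule of A, let r be a natural number, and let ℓ ∈ A and e : Fin (r+1) → A. Suppose that for every m ∈ {1, 2, …, r+1} the element ∑_{i=0}^{r} (m : ℚ)^i • (ℓ^i * e_{r-i}) belongs to S. Then ℓ^i * e_{r-i} ∈ S for every i ∈ {0, 1, …, r}. -/

import Mathlib

/-- If all the combinations of vectors `x j` given by the rows of an invertible matrix lie in a
submodule, then so does each `x j`. -/
theorem Submodule.mem_of_forall_sum_matrix_smul_mem {R M n : Type*} [CommRing R] [AddCommGroup M]
    [Module R M] [Fintype n] [DecidableEq n] (S : Submodule R M) {V : Matrix n n R}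
    (hV : IsUnit V.det) {x : n → M} (h : ∀ k, ∑ j, V k j • x j ∈ S) (i : n) : x i ∈ S := by
  have key : ∑ k, V⁻¹ i k • ∑ j, V k j • x j = x i := by
    simp_rw [Finset.smul_sum, smul_smul]
    rw [Finset.sum_comm]
    simp_rw [← Finset.sum_smul, ← Matrix.mul_apply, Matrix.nonsing_inv_mul V hV,
      Matrix.one_apply, ite_smul, one_smul, zero_smul]
    simp
  rw [← key]
  exact S.sum_mem fun k _ => S.smul_mem _ (h k)

/-- Ring-theoretic form of Proposition 1.4: in a commutative `ℚ`-algebra `A`, if for every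
`m ∈ {1, …, r+1}` the element `∑_{i=0}^{r} (m : ℚ)^i • (ℓ^i * e (r - i))` belongs to a
`ℚ`-submodule `S` of `A`, then `ℓ^i * e (r - i) ∈ S` for every `i ∈ {0, …, r}`. -/
theorem pow_mul_mem_of_twisted_top_chern_mem (A : Type*) [CommRing A] [Algebra ℚ A]
    (S : Submodule ℚ A) (r : ℕ) (ℓ : A) (e : Fin (r + 1) → A)
    (h : ∀ m : ℕ, 1 ≤ m → m ≤ r + 1 →
      (∑ i : Fin (r + 1), ((m : ℚ)) ^ (i : ℕ) • (ℓ ^ (i : ℕ) * e ⟨r - (i : ℕ), by omega⟩)) ∈ S) :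
    ∀ i : Fin (r + 1), ℓ ^ (i : ℕ) * e ⟨r - (i : ℕ), by omega⟩ ∈ S := by
  have hV : IsUnit (Matrix.vandermonde fun k : Fin (r + 1) => (((k : ℕ) + 1 : ℕ) : ℚ)).det := by
    refine isUnit_iff_ne_zero.mpr (Matrix.det_vandermonde_ne_zero_iff.mpr fun a b hab => ?_)
    exact Fin.ext (Nat.succ_injective (Nat.cast_injective hab))
  exact S.mem_of_forall_sum_matrix_smul_mem hV
    (x := fun i : Fin (r + 1) => ℓ ^ (i : ℕ) * e ⟨r - (i : ℕ), by omega⟩)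
    fun k => h (k + 1) (by omega) (by omega)
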